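/- Let f ∈ WRP with sign ε and dual g. For β ∈ F_q^* define A(β) = Σ_{y,z ∈ F_p^*} Σ_{x∈F_q} ξ_p^{y·f(x) − z·Tr(βx)}. Then: (i) A(β) = 0 for every β ∈ F_q^* \ Supp(W_f); (ii) for every nonzero β ∈ Supp(W_f), if n+s is even then A(β) = ε(p−1)²√(p*)^{n+s} when g(β) = 0 and A(β) = −ε(p−1)√(p*)^{n+s} when g(β) ≠ 0; and if n+s is odd then A(β) = 0 when g(β) = 0 and A(β) = ε η_0(g(β))(p−1)√(p*)^{n+s+1} when g(β) ≠ 0. -/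

import Mathlib

open scoped BigOperators Classical

noncomputable section

/-- `ξ_p^j` for `j : ZMod p`, where `ξ_p = exp(2πi/p)` and the exponent `j`
is lifted to a natural number. -/
def ep (p : ℕ) (j : ZMod p) : ℂ :=
  Complex.exp (2 * Real.pi * Complex.I * (j.val : ℂ) / (p : ℂ))

/-- `√(p*)`: equal to `√p` if `p ≡ 1 (mod 4)` and to `i√p` if `p ≡ 3 (mod 4)`. -/
def sqrtPStar (p : ℕ) : ℂ :=
  if p % 4 = 1 then ((Real.sqrt p : ℝ) : ℂ) else Complex.I * ((Real.sqrt p : ℝ) : ℂ)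

/-- The quadratic character `η₀` of `F_p` (extended by `η₀(0) = 0`), with values in `ℂ`. -/
def eta0 (p : ℕ) [Fact p.Prime] (j : ZMod p) : ℂ :=
  ((quadraticChar (ZMod p) j : ℤ) : ℂ)

/-- The Walsh transform of `f : F_q → F_p`. -/
def walsh (p : ℕ) {F : Type*} [Field F] [Fintype F] [Algebra (ZMod p) F]
    (f : F → ZMod p) (β : F) : ℂ :=
  ∑ x : F, ep p (f x - Algebra.trace (ZMod p) F (β * x))

/-- `f` is weakly regular `s`-plateaued with sign `ε` and dual `g`:
`W_f(β) = ε √(p*)^{n+s} ξ_p^{g(β)}` on the Walsh support, `W_f(β) = 0` off it,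
and `g` vanishes off the Walsh support. -/
def IsWeaklyRegularPlateaued (p n s : ℕ) {F : Type*} [Field F] [Fintype F]
    [Algebra (ZMod p) F] (f : F → ZMod p) (ε : ℂ) (g : F → ZMod p) : Prop :=
  (ε = 1 ∨ ε = -1) ∧
  (∀ β : F, walsh p f β ≠ 0 →
      walsh p f β = ε * sqrtPStar p ^ (n + s) * ep p (g β)) ∧
  (∀ β : F, walsh p f β = 0 → g β = 0)

/-- `f` lies in the class `WRP`: weakly regular `s`-plateaued with sign `ε` and dual `g`,
unbalanced, `f(0) = 0`, and `f(ax) = a^h f(x)` for some positive even `h` with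
`gcd(h-1, p-1) = 1`. -/
def IsWRP (p n s : ℕ) {F : Type*} [Field F] [Fintype F]
    [Algebra (ZMod p) F] (f : F → ZMod p) (ε : ℂ) (g : F → ZMod p) : Prop :=
  IsWeaklyRegularPlateaued p n s f ε g ∧
  walsh p f 0 ≠ 0 ∧
  f 0 = 0 ∧
  ∃ h : ℕ, 0 < h ∧ Even h ∧ Nat.gcd (h - 1) (p - 1) = 1 ∧
    ∀ (a : (ZMod p)ˣ) (x : F),
      f (algebraMap (ZMod p) F (a : ZMod p) * x) = (a : ZMod p) ^ h * f x

/-- The exponential sum `A(β) = Σ_{y,z ∈ F_p^*} Σ_{x ∈ F_q} ξ_p^{y f(x) - z Tr(βx)}`. -/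
def Asum (p : ℕ) [NeZero p] {F : Type*} [Field F] [Fintype F] [Algebra (ZMod p) F]
    (f : F → ZMod p) (β : F) : ℂ :=
  ∑ y : (ZMod p)ˣ, ∑ z : (ZMod p)ˣ, ∑ x : F,
    ep p ((y : ZMod p) * f x - (z : ZMod p) * Algebra.trace (ZMod p) F (β * x))

/-- The `q`-factorial `∏_{i=1}^n (1 - x^i)`, without the normalizing factor `(1 - x)^n`. -/
def qFactorial {K : Type*} [Field K] (x : K) (n : ℕ) : K :=
  ∏ i ∈ Finset.range n, (1 - x ^ (i + 1))

/-- The Gaussian binomial coefficient `[n choose k]_x`. -/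
def qChoose {K : Type*} [Field K] (x : K) (n k : ℕ) : K :=
  if k ≤ n then qFactorial x n / (qFactorial x k * qFactorial x (n - k)) else 0

section GaussianBinomial

variable {K : Type*} [Field K] {x : K} {N : ℕ}

lemma qFactorial_succ (x : K) (n : ℕ) :
    qFactorial x (n + 1) = qFactorial x n * (1 - x ^ (n + 1)) :=
  Finset.prod_range_succ _ _

lemma qFactorial_ne_zero (hx : ∀ k, 0 < k → k ≤ N → x ^ k ≠ 1) {n : ℕ} (hn : n ≤ N) :
    qFactorial x n ≠ 0 := by
  refine Finset.prod_ne_zero_iff.mpr fun i hi => sub_ne_zero.mpr (hx _ i.succ_pos ?_).symm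
  have := Finset.mem_range.mp hi
  omega

lemma qChoose_zero_right (hx : ∀ k, 0 < k → k ≤ N → x ^ k ≠ 1) {n : ℕ} (hn : n ≤ N) :
    qChoose x n 0 = 1 := by
  have := qFactorial_ne_zero hx hn
  have h0 : qFactorial x 0 = 1 := by simp [qFactorial]
  simp [qChoose, h0, this]

lemma qChoose_of_lt (x : K) {n k : ℕ} (h : n < k) : qChoose x n k = 0 := by
  simp [qChoose, Nat.not_le.mpr h]

lemma one_sub_pow_mul_qChoose_succ_left (hx : ∀ k, 0 < k → k ≤ N → x ^ k ≠ 1) {n k : ℕ}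
    (hn : n + 1 ≤ N) (hk : k ≤ n + 1) :
    (1 - x ^ (n + 1 - k)) * qChoose x (n + 1) k = (1 - x ^ (n + 1)) * qChoose x n k := by
  rcases hk.eq_or_lt with rfl | hk
  · simp [qChoose_of_lt]
  obtain ⟨j, rfl⟩ := Nat.exists_eq_add_of_le (Nat.lt_succ_iff.mp hk)
  have e : k + j + 1 - k = j + 1 := by omega
  have h1 := qFactorial_ne_zero hx (n := k) (by omega)
  have h2 := qFactorial_ne_zero hx (n := j) (by omega)
  have h3 : 1 - x ^ (j + 1) ≠ 0 := sub_ne_zero.mpr (hx _ j.succ_pos (by omega)).symm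
  rw [qChoose, qChoose, if_pos (by omega), if_pos (by omega), e, qFactorial_succ, qFactorial_succ,
    Nat.add_sub_cancel_left]
  field_simp

lemma one_sub_pow_mul_qChoose_succ_right (hx : ∀ k, 0 < k → k ≤ N → x ^ k ≠ 1) {n k : ℕ}
    (hn : n ≤ N) (hk : k < n) :
    (1 - x ^ (k + 1)) * qChoose x n (k + 1) = (1 - x ^ (n - k)) * qChoose x n k := by
  obtain ⟨j, rfl⟩ := Nat.exists_eq_add_of_lt hk
  have e : k + j + 1 - k = j + 1 := by omega
  have e' : k + j + 1 - (k + 1) = j := by omega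
  have h1 := qFactorial_ne_zero hx (n := k) (by omega)
  have h2 := qFactorial_ne_zero hx (n := j) (by omega)
  have h3 : 1 - x ^ (j + 1) ≠ 0 := sub_ne_zero.mpr (hx _ j.succ_pos (by omega)).symm
  have h4 : 1 - x ^ (k + 1) ≠ 0 := sub_ne_zero.mpr (hx _ k.succ_pos (by omega)).symm
  rw [qChoose, qChoose, if_pos (by omega), if_pos (by omega), e, e', qFactorial_succ x k,
    qFactorial_succ x j]
  field_simp

lemma qChoose_succ_succ (hx : ∀ k, 0 < k → k ≤ N → x ^ k ≠ 1) {n k : ℕ}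
    (hn : n + 1 ≤ N) (hk : k ≤ n) :
    qChoose x (n + 1) (k + 1) = qChoose x n (k + 1) + x ^ (n - k) * qChoose x n k := by
  have h4 : 1 - x ^ (k + 1) ≠ 0 := sub_ne_zero.mpr (hx _ k.succ_pos (by omega)).symm
  rcases hk.eq_or_lt with rfl | hk
  · have h1 := qFactorial_ne_zero hx (n := k) (by omega)
    have h2 := qFactorial_ne_zero hx (n := k + 1) (by omega)
    have h0 : qFactorial x 0 = 1 := by simp [qFactorial]
    simp [qChoose, h0, h1, h2]
  · have a := one_sub_pow_mul_qChoose_succ_left hx hn (k := k + 1) (by omega)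
    have b := one_sub_pow_mul_qChoose_succ_right hx (n := n) (by omega) hk
    have a' := one_sub_pow_mul_qChoose_succ_right hx hn (k := k) (by omega)
    have c := one_sub_pow_mul_qChoose_succ_left hx hn (k := k) (by omega)
    refine mul_left_cancel₀ h4 ?_
    rw [a', c, mul_add, b, show n + 1 = (n - k) + (k + 1) by omega, pow_add]
    ring

/-- Gauss's recursion for the alternating sum of Gaussian binomial coefficients. -/
lemma sum_neg_one_pow_mul_qChoose_add_two (hx : ∀ k, 0 < k → k ≤ N → x ^ k ≠ 1) {m : ℕ}
    (hm : m + 2 ≤ N) :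
    ∑ k ∈ Finset.range (m + 3), (-1) ^ k * qChoose x (m + 2) k =
      (1 - x ^ (m + 1)) * ∑ k ∈ Finset.range (m + 1), (-1) ^ k * qChoose x m k := by
  have h1 : ∑ k ∈ Finset.range (m + 3), (-1) ^ k * qChoose x (m + 2) k =
      ∑ k ∈ Finset.range (m + 3), (-1) ^ k * qChoose x (m + 1) k -
      ∑ k ∈ Finset.range (m + 2), (-1) ^ k * (x ^ (m + 1 - k) * qChoose x (m + 1) k) := by
    rw [Finset.sum_range_succ', Finset.sum_range_succ' _ (m + 2), qChoose_zero_right hx hm,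
      qChoose_zero_right hx (n := m + 1) (by omega), add_sub_right_comm,
      ← Finset.sum_sub_distrib]
    congr 1
    refine Finset.sum_congr rfl fun k hk => ?_
    have := Finset.mem_range.mp hk
    rw [qChoose_succ_succ hx (n := m + 1) hm (by omega)]
    ring
  rw [h1, Finset.sum_range_succ _ (m + 2), qChoose_of_lt x (Nat.lt_succ_self _), mul_zero,
    add_zero, ← Finset.sum_sub_distrib]
  have h2 : ∀ k ∈ Finset.range (m + 2), (-1) ^ k * qChoose x (m + 1) k -
      (-1) ^ k * (x ^ (m + 1 - k) * qChoose x (m + 1) k) =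
      (1 - x ^ (m + 1)) * ((-1) ^ k * qChoose x m k) := fun k hk => by
    have := Finset.mem_range.mp hk
    have := one_sub_pow_mul_qChoose_succ_left hx (n := m) (k := k) (by omega) (by omega)
    linear_combination (-1) ^ k * this
  rw [Finset.sum_congr rfl h2, ← Finset.mul_sum, Finset.sum_range_succ _ (m + 1),
    qChoose_of_lt x (Nat.lt_succ_self _), mul_zero, add_zero]

lemma sum_neg_one_pow_mul_qChoose_two_mul (hx : ∀ k, 0 < k → k ≤ N → x ^ k ≠ 1) (m : ℕ)
    (hm : 2 * m ≤ N) :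
    ∑ k ∈ Finset.range (2 * m + 1), (-1) ^ k * qChoose x (2 * m) k =
      ∏ i ∈ Finset.range m, (1 - x ^ (2 * i + 1)) := by
  induction m with
  | zero => simp [qChoose, qFactorial]
  | succ m ih =>
    rw [Finset.prod_range_succ, ← ih (by omega), mul_comm _ (1 - x ^ (2 * m + 1))]
    exact sum_neg_one_pow_mul_qChoose_add_two hx hm

/-- For a primitive `n`-th root of unity, `[n - 1 choose k] = (-1)^k x^{-k(k+1)/2}`, here with
`x = z^{-2}`. -/
lemma neg_one_pow_mul_qChoose_inv_sq {z : K} {n k : ℕ} (hn : 0 < n)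
    (hz : IsPrimitiveRoot (z ^ 2)⁻¹ n) (hk : k ≤ n - 1) :
    (-1) ^ k * qChoose (z ^ 2)⁻¹ (n - 1) k = z ^ (k * (k + 1)) := by
  have hx : ∀ j, 0 < j → j ≤ n - 1 → (z ^ 2)⁻¹ ^ j ≠ 1 := fun j hj hjn =>
    hz.pow_ne_one_of_pos_of_lt hj.ne' (by omega)
  have hz0 : z ≠ 0 := by
    rintro rfl
    exact hz.ne_zero hn.ne' (by simp)
  induction k with
  | zero => simp [qChoose_zero_right hx le_rfl]
  | succ k ih =>
    have h := one_sub_pow_mul_qChoose_succ_right hx (n := n - 1) (k := k) le_rfl (by omega)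
    have h4 : 1 - (z ^ 2)⁻¹ ^ (k + 1) ≠ 0 := sub_ne_zero.mpr (hx _ k.succ_pos hk).symm
    have h5 : (z ^ 2)⁻¹ ^ (n - 1 - k) = z ^ (2 * (k + 1)) := by
      have h6 : (z ^ 2)⁻¹ ^ (n - 1 - k) * (z ^ 2)⁻¹ ^ (k + 1) = 1 := by
        rw [← pow_add, show n - 1 - k + (k + 1) = n by omega, hz.pow_eq_one]
      rw [inv_pow _ (k + 1), ← pow_mul] at h6
      exact eq_of_mul_inv_eq_one h6
    have h7 : 1 - z ^ (2 * (k + 1)) = - (1 - (z ^ 2)⁻¹ ^ (k + 1)) * z ^ (2 * (k + 1)) := by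
      rw [inv_pow, ← pow_mul]
      field_simp
      ring
    rw [h5, h7] at h
    have h8 : qChoose (z ^ 2)⁻¹ (n - 1) (k + 1) =
        - z ^ (2 * (k + 1)) * qChoose (z ^ 2)⁻¹ (n - 1) k := by
      refine mul_left_cancel₀ h4 ?_
      rw [h]; ring
    rw [h8, show (k + 1) * (k + 1 + 1) = k * (k + 1) + 2 * (k + 1) by ring, pow_add z,
      ← ih (by omega)]
    ring

/-- Gauss's product formula for `∑ z^{k(k+1)}` over a full period. -/
lemma sum_pow_mul_succ_eq_prod {z : K} {m : ℕ} (hz : IsPrimitiveRoot (z ^ 2)⁻¹ (2 * m + 1)) :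
    ∑ k ∈ Finset.range (2 * m + 1), z ^ (k * (k + 1)) =
      ∏ i ∈ Finset.range m, (1 - (z ^ 2)⁻¹ ^ (2 * i + 1)) := by
  have hx : ∀ j, 0 < j → j ≤ 2 * m → (z ^ 2)⁻¹ ^ j ≠ 1 := fun j hj hjn =>
    hz.pow_ne_one_of_pos_of_lt hj.ne' (by omega)
  rw [← sum_neg_one_pow_mul_qChoose_two_mul hx m le_rfl]
  refine Finset.sum_congr rfl fun k hk => ?_
  have := Finset.mem_range.mp hk
  exact (neg_one_pow_mul_qChoose_inv_sq (Nat.succ_pos _) hz (by omega)).symm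

end GaussianBinomial

section GaussSum

variable (p : ℕ)

lemma ep_eq_stdAddChar [NeZero p] (j : ZMod p) : ep p j = ZMod.stdAddChar j := by
  conv_rhs => rw [← ZMod.natCast_zmod_val j]
  have := ZMod.stdAddChar_coe (N := p) (j.val : ℤ)
  push_cast at this
  rw [this, ep]

lemma ep_add [NeZero p] (a b : ZMod p) : ep p (a + b) = ep p a * ep p b := by
  simp only [ep_eq_stdAddChar, AddChar.map_add_eq_mul]

lemma ep_zero [NeZero p] : ep p 0 = 1 := by
  simp only [ep_eq_stdAddChar, AddChar.map_zero_eq_one]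

lemma ep_natCast_mul [NeZero p] (k : ℕ) (j : ZMod p) : ep p (k * j) = ep p j ^ k := by
  rw [ep_eq_stdAddChar, ep_eq_stdAddChar, ← nsmul_eq_mul, AddChar.map_nsmul_eq_pow]

lemma ep_natCast [NeZero p] (k : ℕ) : ep p k = ep p 1 ^ k := by
  rw [← ep_natCast_mul, mul_one]

lemma ep_injective [NeZero p] : Function.Injective (ep p) := fun a b h => by
  rw [ep_eq_stdAddChar, ep_eq_stdAddChar] at h
  exact ZMod.injective_stdAddChar h

lemma ep_ne_zero (j : ZMod p) : ep p j ≠ 0 := Complex.exp_ne_zero _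

lemma isPrimitiveRoot_ep [Fact p.Prime] {j : ZMod p} (hj : j ≠ 0) :
    IsPrimitiveRoot (ep p j) p := by
  have h : ∀ k : ℕ, ep p j ^ k = 1 ↔ p ∣ k := fun k => by
    rw [← ep_natCast_mul, ← ep_zero p, (ep_injective p).eq_iff, mul_eq_zero, or_iff_left hj,
      ZMod.natCast_eq_zero_iff]
  exact ⟨(h p).mpr dvd_rfl, fun k => (h k).mp⟩

lemma ep_one_pow_eq_exp [Fact p.Prime] (k : ℕ) :
    ep p 1 ^ k = Complex.exp ((2 * Real.pi * k / p : ℝ) * Complex.I) := by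
  rw [ep, ← Complex.exp_nat_mul, ZMod.val_one]
  congr 1
  push_cast
  ring

lemma ep_one_pow_sub_inv [Fact p.Prime] (k : ℕ) :
    ep p 1 ^ k - (ep p 1 ^ k)⁻¹ = Complex.I * (2 * Real.sin (2 * Real.pi * k / p) : ℝ) := by
  rw [ep_one_pow_eq_exp, ← Complex.exp_neg]
  push_cast
  rw [← neg_mul, Complex.exp_mul_I, Complex.exp_mul_I, Complex.cos_neg, Complex.sin_neg]
  ring

lemma sum_eta0_mul_ep [Fact p.Prime] (hp : p ≠ 2) :
    ∑ j : ZMod p, eta0 p j * ep p j = ∑ x : ZMod p, ep p (x ^ 2) := by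
  have hchar : ringChar (ZMod p) ≠ 2 := by rwa [ZMod.ringChar_zmod_n]
  have h0 : ∑ j : ZMod p, ep p j = 0 := by
    simp only [ep_eq_stdAddChar]
    refine AddChar.sum_eq_zero_of_ne_one fun h => ?_
    have h1 : (1 : ZMod p) = 0 := ZMod.injective_stdAddChar (by rw [h]; rfl)
    exact one_ne_zero h1
  rw [← Finset.sum_fiberwise Finset.univ (fun x : ZMod p => x ^ 2) (fun x => ep p (x ^ 2)),
    ← add_zero (∑ j : ZMod p, _), ← h0, ← Finset.sum_add_distrib]
  refine Finset.sum_congr rfl fun j _ => ?_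
  have hc := quadraticChar_card_sqrts hchar j
  rw [Finset.sum_congr rfl (g := fun _ => ep p j)
    (fun x hx => by rw [(Finset.mem_filter.mp hx).2]), Finset.sum_const, nsmul_eq_mul]
  have hc' : ((Finset.univ.filter fun x : ZMod p => x ^ 2 = j).card : ℤ) =
      quadraticChar (ZMod p) j + 1 := by
    rw [← hc]; congr 2; ext x; simp
  have hc'' : ((Finset.univ.filter fun x : ZMod p => x ^ 2 = j).card : ℂ) = eta0 p j + 1 := by
    rw [eta0]; exact_mod_cast congrArg (Int.cast : ℤ → ℂ) hc'
  rw [hc'']; ring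

lemma sum_zmod_eq_sum_range [NeZero p] {M : Type*} [AddCommMonoid M] (F : ZMod p → M) :
    ∑ x : ZMod p, F x = ∑ k ∈ Finset.range p, F k :=
  Finset.sum_bij' (fun x _ => x.val) (fun k _ => (k : ZMod p))
    (fun x _ => Finset.mem_range.mpr x.val_lt) (fun _ _ => Finset.mem_univ _)
    (fun x _ => ZMod.natCast_zmod_val x)
    (fun k hk => ZMod.val_cast_of_lt (Finset.mem_range.mp hk))
    (fun x _ => by rw [ZMod.natCast_zmod_val])

lemma sum_ep_sq_eq_prod [Fact p.Prime] {m : ℕ} (hm : p = 2 * m + 1) :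
    ∑ x : ZMod p, ep p (x ^ 2) =
      ∏ i ∈ Finset.range m, (ep p 1 ^ (2 * i + 1) - (ep p 1 ^ (2 * i + 1))⁻¹) := by
  have hpm : (2 * m + 1 : ZMod p) = 0 := by
    have h := ZMod.natCast_self p
    have h' := congrArg (Nat.cast : ℕ → ZMod p) hm
    rw [h] at h'
    push_cast at h'
    exact h'.symm
  have hz : IsPrimitiveRoot (ep p 1 ^ 2)⁻¹ (2 * m + 1) := by
    rw [← hm]
    refine IsPrimitiveRoot.inv ?_
    have h2 : (2 : ZMod p) ≠ 0 := fun h => by simp [h] at hpm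
    have := isPrimitiveRoot_ep p h2
    rwa [← Nat.cast_ofNat, ep_natCast] at this
  have hs : ∑ i ∈ Finset.range m, (2 * i + 1) = m ^ 2 := by
    clear hz hpm hm
    induction m with
    | zero => rfl
    | succ m ih => rw [Finset.sum_range_succ, ih]; ring
  have h1 : ∑ x : ZMod p, ep p (x ^ 2) =
      ep p 1 ^ m ^ 2 * ∑ k ∈ Finset.range (2 * m + 1), ep p 1 ^ (k * (k + 1)) := by
    rw [← (Equiv.subRight (m : ZMod p)).sum_comp, sum_zmod_eq_sum_range, Finset.mul_sum, ← hm]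
    refine Finset.sum_congr rfl fun k _ => ?_
    rw [← ep_natCast, ← ep_natCast, ← ep_add]
    congr 1
    simp only [Equiv.subRight_apply]
    push_cast
    linear_combination - (k : ZMod p) * hpm
  rw [h1, sum_pow_mul_succ_eq_prod hz, ← hs, ← Finset.prod_pow_eq_pow_sum,
    ← Finset.prod_mul_distrib]
  refine Finset.prod_congr rfl fun i _ => ?_
  have := ep_ne_zero p 1
  rw [inv_pow, pow_right_comm, mul_sub, mul_one, sq (_ ^ _), mul_inv,
    mul_inv_cancel_left₀ (pow_ne_zero _ this)]

lemma exists_prod_sin_eq {a b : ℕ} (h1 : 4 * a < p + 2) (h2 : p < 4 * a + 2)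
    (h3 : 2 * (a + b) < p + 1) :
    ∃ r : ℝ, 0 < r ∧
      ∏ i ∈ Finset.range (a + b), 2 * Real.sin (2 * Real.pi * (2 * i + 1 : ℕ) / p) =
        (-1) ^ b * r := by
  have hpi := Real.pi_pos
  rcases Nat.eq_zero_or_pos p with rfl | hp
  · obtain ⟨rfl, rfl⟩ : a = 0 ∧ b = 0 := by omega
    exact ⟨1, one_pos, by simp⟩
  have hp' : (0 : ℝ) < p := by exact_mod_cast hp
  refine ⟨(∏ i ∈ Finset.range a, 2 * Real.sin (2 * Real.pi * (2 * i + 1 : ℕ) / p)) *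
    ∏ i ∈ Finset.range b, -(2 * Real.sin (2 * Real.pi * (2 * (a + i) + 1 : ℕ) / p)),
    mul_pos (Finset.prod_pos fun i hi => ?_) (Finset.prod_pos fun i hi => ?_), ?_⟩
  · have hi := Finset.mem_range.mp hi
    have h : ((2 * (2 * i + 1) : ℕ) : ℝ) < p := by exact_mod_cast (by omega)
    refine mul_pos two_pos (Real.sin_pos_of_pos_of_lt_pi (by positivity) ?_)
    rw [div_lt_iff₀ hp']
    push_cast at h ⊢
    nlinarith
  · have hi := Finset.mem_range.mp hi
    have h : (p : ℝ) < ((2 * (2 * (a + i) + 1) : ℕ) : ℝ) := by exact_mod_cast (by omega)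
    have h' : ((2 * (a + i) + 1 : ℕ) : ℝ) < p := by exact_mod_cast (by omega)
    have : 0 < Real.sin (2 * Real.pi * (2 * (a + i) + 1 : ℕ) / p - Real.pi) := by
      refine Real.sin_pos_of_pos_of_lt_pi ?_ ?_
      · rw [sub_pos, lt_div_iff₀ hp']
        push_cast at h ⊢
        nlinarith
      · rw [sub_lt_iff_lt_add, div_lt_iff₀ hp']
        nlinarith
    rw [Real.sin_sub_pi] at this
    linarith
  · rw [Finset.prod_range_add, Finset.prod_neg, Finset.card_range]
    have : ((-1 : ℝ) ^ b) * (-1) ^ b = 1 := by rw [← mul_pow]; simp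
    linear_combination (-(∏ i ∈ Finset.range a, 2 * Real.sin (2 * Real.pi * (2 * i + 1 : ℕ) / p)) *
      ∏ i ∈ Finset.range b, (2 * Real.sin (2 * Real.pi * (2 * (a + i) + 1 : ℕ) / p))) * this

lemma gauss_sum_pow_four [Fact p.Prime] (hp : p ≠ 2) :
    (∑ j : ZMod p, eta0 p j * ep p j) ^ 4 = (p : ℂ) ^ 2 := by
  have hchar : ringChar (ZMod p) ≠ 2 := by rwa [ZMod.ringChar_zmod_n]
  have hχ : (quadraticChar (ZMod p)).ringHomComp (Int.castRingHom ℂ) ≠ 1 := by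
    rw [MulChar.ringHomComp_ne_one_iff (RingHom.injective_int _)]
    exact quadraticChar_ne_one hchar
  have hsq := gaussSum_sq hχ ((quadraticChar_isQuadratic (ZMod p)).comp _)
    (ZMod.isPrimitive_stdAddChar p)
  have hG : gaussSum ((quadraticChar (ZMod p)).ringHomComp (Int.castRingHom ℂ)) ZMod.stdAddChar =
      ∑ j : ZMod p, eta0 p j * ep p j :=
    Finset.sum_congr rfl fun j _ => by rw [ep_eq_stdAddChar]; rfl
  have h1 : ((quadraticChar (ZMod p) (-1) : ℤ) : ℂ) ^ 2 = 1 := by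
    exact_mod_cast congrArg (Int.cast : ℤ → ℂ)
      (quadraticChar_sq_one (F := ZMod p) (neg_ne_zero.mpr one_ne_zero))
  rw [hG, ZMod.card] at hsq
  rw [show (4 : ℕ) = 2 * 2 from rfl, pow_mul, hsq, mul_pow]
  rw [MulChar.ringHomComp_apply, eq_intCast, h1, one_mul]

/-- Gauss's determination of the sign of the quadratic Gauss sum. -/
theorem gauss_sum_eq_sqrtPStar [Fact p.Prime] (hp : p ≠ 2) :
    ∑ j : ZMod p, eta0 p j * ep p j = sqrtPStar p := by
  have hodd : p % 2 = 1 := (Fact.out : p.Prime).eq_two_or_odd.resolve_left hp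
  have key : ∃ r : ℝ, 0 < r ∧ ∑ j : ZMod p, eta0 p j * ep p j =
      (if p % 4 = 1 then 1 else Complex.I) * r := by
    obtain ⟨t, a, hm, h1, h2, hI⟩ : ∃ t a : ℕ, p = 2 * (a + t) + 1 ∧ 4 * a < p + 2 ∧
        p < 4 * a + 2 ∧ Complex.I ^ (a + t) * (-1) ^ t =
          (if p % 4 = 1 then 1 else Complex.I) := by
      have hI : ∀ t : ℕ, Complex.I ^ (t + t) * (-1) ^ t = 1 := fun t => by
        rw [← two_mul, pow_mul, Complex.I_sq, ← mul_pow]; simp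
      rcases (by omega : p % 4 = 1 ∨ p % 4 = 3) with h | h
      · refine ⟨p / 4, p / 4, by omega, by omega, by omega, ?_⟩
        rw [if_pos h, hI]
      · refine ⟨p / 4, p / 4 + 1, by omega, by omega, by omega, ?_⟩
        rw [if_neg (by omega), add_right_comm, pow_succ, mul_right_comm, hI, one_mul]
    obtain ⟨r, hr, hprod⟩ := exists_prod_sin_eq p h1 h2 (b := t) (by omega)
    refine ⟨r, hr, ?_⟩
    rw [sum_eta0_mul_ep p hp, sum_ep_sq_eq_prod p hm]
    simp only [ep_one_pow_sub_inv]
    rw [Finset.prod_mul_distrib, Finset.prod_const, Finset.card_range, ← Complex.ofReal_prod,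
      hprod, ← hI]
    push_cast
    ring
  obtain ⟨r, hr, h⟩ := key
  have h4 := gauss_sum_pow_four p hp
  have hc : (if p % 4 = 1 then 1 else Complex.I : ℂ) ^ 4 = 1 := by split_ifs <;> simp
  rw [h, mul_pow, hc, one_mul] at h4
  have hr4 : r ^ 4 = (p : ℝ) ^ 2 := by exact_mod_cast h4
  have hr2 : r ^ 2 = p := by
    have : (r ^ 2) ^ 2 = (p : ℝ) ^ 2 := by rw [← hr4]; ring
    exact (pow_left_inj₀ (by positivity) (by positivity) two_ne_zero).mp this
  have hrs : Real.sqrt p = r := by rw [← hr2, Real.sqrt_sq hr.le]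
  rw [h, sqrtPStar, hrs]
  split_ifs <;> simp

end GaussSum

section Galois

open Polynomial in
lemma aeval_eq_zero_of_isPrimitiveRoot {K : Type*} [Field K] [CharZero K] {n : ℕ} (hn : 0 < n)
    {z w : K} (hz : IsPrimitiveRoot z n) (hw : IsPrimitiveRoot w n) {Q : ℤ[X]}
    (hQ : aeval z Q = 0) : aeval w Q = 0 := by
  have h := minpoly.isIntegrallyClosed_dvd (hz.isIntegral hn) hQ
  rw [← cyclotomic_eq_minpoly hz hn, cyclotomic_eq_minpoly hw hn] at h
  obtain ⟨R, rfl⟩ := h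
  rw [map_mul, minpoly.aeval, zero_mul]

variable (p : ℕ) [Fact p.Prime]

lemma eta0_mul (a b : ZMod p) : eta0 p (a * b) = eta0 p a * eta0 p b := by
  simp only [eta0, map_mul, Int.cast_mul]

lemma eta0_zero : eta0 p 0 = 0 := by
  rw [eta0, quadraticChar_zero, Int.cast_zero]

lemma eta0_sq {a : ZMod p} (ha : a ≠ 0) : eta0 p a ^ 2 = 1 := by
  rw [eta0]
  exact_mod_cast congrArg (Int.cast : ℤ → ℂ) (quadraticChar_sq_one ha)

lemma sum_eta0_mul_ep_mul (hp : p ≠ 2) (a : ZMod p) :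
    ∑ j : ZMod p, eta0 p j * ep p (j * a) = eta0 p a * sqrtPStar p := by
  rcases eq_or_ne a 0 with rfl | ha
  · have hchar : ringChar (ZMod p) ≠ 2 := by rwa [ZMod.ringChar_zmod_n]
    have h := quadraticChar_sum_zero hchar
    simp only [mul_zero, ep_zero, mul_one, eta0_zero, zero_mul]
    simp only [eta0]
    exact_mod_cast congrArg (Int.cast : ℤ → ℂ) h
  · have h : eta0 p a * ∑ j : ZMod p, eta0 p j * ep p (j * a) = sqrtPStar p := by
      rw [← gauss_sum_eq_sqrtPStar p hp, eq_comm, ← Equiv.sum_comp (Equiv.mulRight₀ a ha),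
        Finset.mul_sum]
      refine Finset.sum_congr rfl fun j _ => ?_
      rw [Equiv.mulRight₀_apply, eta0_mul]
      ring
    rw [← h, ← mul_assoc, ← sq, eta0_sq p ha, one_mul]

lemma sum_units_zmod {M : Type*} [AddCommGroup M] (F : ZMod p → M) :
    ∑ y : (ZMod p)ˣ, F y = ∑ j : ZMod p, F j - F 0 := by
  rw [← Finset.sum_erase_eq_sub (Finset.mem_univ 0)]
  refine Finset.sum_bij (fun y _ => (y : ZMod p)) (fun y _ => by simp)
    (fun _ _ _ _ h => Units.ext h) (fun j hj => ?_) fun _ _ => rfl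
  exact ⟨Units.mk0 j (Finset.ne_of_mem_erase hj), Finset.mem_univ _, rfl⟩

lemma sum_units_ep_mul (a : ZMod p) :
    ∑ y : (ZMod p)ˣ, ep p (y * a) = if a = 0 then (p : ℂ) - 1 else -1 := by
  have h := AddChar.sum_mulShift a (ZMod.isPrimitive_stdAddChar p)
  simp only [← ep_eq_stdAddChar, ZMod.card] at h
  rw [sum_units_zmod p (fun y => ep p (y * a)), h, zero_mul, ep_zero]
  split_ifs <;> simp

lemma sum_units_eta0_mul_ep_mul (hp : p ≠ 2) (a : ZMod p) :
    ∑ y : (ZMod p)ˣ, eta0 p y * ep p (y * a) = eta0 p a * sqrtPStar p := by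
  rw [sum_units_zmod p (fun y => eta0 p y * ep p (y * a)), sum_eta0_mul_ep_mul p hp, eta0_zero,
    zero_mul, sub_zero]

end Galois

section Walsh

variable (p : ℕ) {F : Type*} [Field F] [Fintype F] [Algebra (ZMod p) F]

/-- The image of the Walsh transform under the automorphism `ξ_p ↦ ξ_p^y` of the cyclotomic
field. -/
def twistedWalsh (f : F → ZMod p) (y : ZMod p) (β : F) : ℂ :=
  ∑ x : F, ep p (y * (f x - Algebra.trace (ZMod p) F (β * x)))

lemma twistedWalsh_one (f : F → ZMod p) (β : F) : twistedWalsh p f 1 β = walsh p f β := by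
  simp only [twistedWalsh, walsh, one_mul]

variable [Fact p.Prime]

open Polynomial in
lemma exists_aeval_ep_eq_twistedWalsh (f : F → ZMod p) (β : F) :
    ∃ P : ℤ[X], ∀ y : ZMod p, aeval (ep p y) P = twistedWalsh p f y β := by
  refine ⟨∑ x : F, X ^ (f x - Algebra.trace (ZMod p) F (β * x)).val, fun y => ?_⟩
  simp only [map_sum, map_pow, aeval_X, twistedWalsh, ← ep_natCast_mul, ZMod.natCast_zmod_val,
    mul_comm y]

open Polynomial in
lemma exists_aeval_ep_eq_eta0_mul (hp : p ≠ 2) :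
    ∃ P : ℤ[X], ∀ y : ZMod p, aeval (ep p y) P = eta0 p y * sqrtPStar p := by
  refine ⟨∑ j : ZMod p, C (quadraticChar (ZMod p) j) * X ^ j.val, fun y => ?_⟩
  rw [← sum_eta0_mul_ep_mul p hp]
  simp only [map_sum, map_mul, map_pow, aeval_X, ← ep_natCast_mul, ZMod.natCast_zmod_val,
    eta0, eq_intCast, map_intCast]

lemma twistedWalsh_eq_zero_iff (f : F → ZMod p) {y : ZMod p} (hy : y ≠ 0) (β : F) :
    twistedWalsh p f y β = 0 ↔ walsh p f β = 0 := by
  have hpos := (Fact.out : p.Prime).pos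
  obtain ⟨P, hP⟩ := exists_aeval_ep_eq_twistedWalsh p f β
  have hy' := isPrimitiveRoot_ep p hy
  have h1' := isPrimitiveRoot_ep p (one_ne_zero (α := ZMod p))
  rw [← twistedWalsh_one, ← hP, ← hP]
  exact ⟨aeval_eq_zero_of_isPrimitiveRoot hpos hy' h1',
    aeval_eq_zero_of_isPrimitiveRoot hpos h1' hy'⟩

open Polynomial in
lemma twistedWalsh_eq_of_walsh_eq (hp : p ≠ 2) {f : F → ZMod p} {y : ZMod p} (hy : y ≠ 0) {β : F}
    {ε : ℂ} (hε : ε = 1 ∨ ε = -1) {N : ℕ} {c : ZMod p}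
    (h : walsh p f β = ε * sqrtPStar p ^ N * ep p c) :
    twistedWalsh p f y β = ε * (eta0 p y * sqrtPStar p) ^ N * ep p (y * c) := by
  obtain ⟨P, hP⟩ := exists_aeval_ep_eq_twistedWalsh p f β
  obtain ⟨G, hG⟩ := exists_aeval_ep_eq_eta0_mul p hp
  obtain ⟨e, rfl⟩ : ∃ e : ℤ, (e : ℂ) = ε := by
    rcases hε with rfl | rfl
    · exact ⟨1, by simp⟩
    · exact ⟨-1, by simp⟩
  have hQ : ∀ z : ZMod p, aeval (ep p z) (P - C e * G ^ N * X ^ c.val) =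
      twistedWalsh p f z β - e * (eta0 p z * sqrtPStar p) ^ N * ep p (z * c) := fun z => by
    simp only [map_sub, map_mul, map_pow, aeval_X, hP, hG, ← ep_natCast_mul,
      ZMod.natCast_zmod_val, eq_intCast, map_intCast, mul_comm z]
  rw [← sub_eq_zero, ← hQ]
  refine aeval_eq_zero_of_isPrimitiveRoot (Fact.out : p.Prime).pos
    (isPrimitiveRoot_ep p (one_ne_zero (α := ZMod p))) (isPrimitiveRoot_ep p hy) ?_
  have h1 : eta0 p 1 = 1 := by rw [eta0, map_one, Int.cast_one]
  rw [hQ, twistedWalsh_one, h, h1, one_mul, one_mul, sub_self]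

lemma walsh_eq_twistedWalsh_of_homogeneous {f : F → ZMod p} {h : ℕ} (hpos : 0 < h) (heven : Even h)
    (hgcd : Nat.gcd (h - 1) (p - 1) = 1)
    (hf : ∀ (a : (ZMod p)ˣ) (x : F),
      f (algebraMap (ZMod p) F (a : ZMod p) * x) = (a : ZMod p) ^ h * f x) (c : (ZMod p)ˣ) :
    ∃ v : (ZMod p)ˣ, ∀ β : F, walsh p f β =
      twistedWalsh p f ((v : ZMod p) ^ 2) (algebraMap (ZMod p) F (c : ZMod p) * β) := by
  have hcop : (Nat.card (ZMod p)ˣ).Coprime (h - 1) := by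
    rw [Nat.card_eq_fintype_card, ZMod.card_units]
    exact Nat.Coprime.symm hgcd
  obtain ⟨d, hd⟩ := (powCoprime hcop).surjective c
  rw [powCoprime_apply] at hd
  obtain ⟨k, hk⟩ := heven
  refine ⟨d⁻¹ ^ k, fun β => ?_⟩
  have hv : ((d⁻¹ ^ k : (ZMod p)ˣ) : ZMod p) ^ 2 = ((d⁻¹ : (ZMod p)ˣ) : ZMod p) ^ h := by
    rw [hk, Units.val_pow_eq_pow_val, ← pow_mul, mul_two]
  have hc : ((d⁻¹ : (ZMod p)ˣ) : ZMod p) ^ h * c = (d⁻¹ : (ZMod p)ˣ) := by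
    rw [← hd, ← Units.val_pow_eq_pow_val, ← Units.val_mul]
    congr 1
    obtain ⟨m, rfl⟩ := Nat.exists_eq_add_of_lt hpos
    rw [zero_add, Nat.add_sub_cancel, pow_succ, inv_pow]
    group
  have hne : algebraMap (ZMod p) F ((d⁻¹ : (ZMod p)ˣ) : ZMod p) ≠ 0 :=
    (map_ne_zero _).mpr d⁻¹.ne_zero
  rw [hv, walsh, twistedWalsh, ← Equiv.sum_comp (Equiv.mulLeft₀ _ hne)]
  refine Finset.sum_congr rfl fun x _ => ?_
  rw [Equiv.mulLeft₀_apply, hf, mul_left_comm β, mul_assoc, ← Algebra.smul_def, ← Algebra.smul_def,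
    map_smul, map_smul, smul_eq_mul, smul_eq_mul, mul_sub, ← mul_assoc _ (c : ZMod p), hc]

lemma Asum_eq_sum_twistedWalsh (f : F → ZMod p) (β : F) :
    Asum p f β = ∑ z : (ZMod p)ˣ, ∑ y : (ZMod p)ˣ,
      twistedWalsh p f y (algebraMap (ZMod p) F (z : ZMod p) * β) := by
  rw [Asum]
  conv_rhs => rw [Finset.sum_comm]
  refine Finset.sum_congr rfl fun y _ => ?_
  rw [← Equiv.sum_comp (Equiv.mulLeft y)]
  refine Finset.sum_congr rfl fun z _ => Finset.sum_congr rfl fun x _ => ?_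
  rw [Equiv.coe_mulLeft, Units.val_mul, mul_assoc _ β, ← Algebra.smul_def, map_smul, smul_eq_mul]
  congr 1
  ring

variable {p}

lemma IsWRP.exists_walsh_eq_twistedWalsh {n s : ℕ} {f g : F → ZMod p} {ε : ℂ}
    (hf : IsWRP p n s f ε g) (c : (ZMod p)ˣ) :
    ∃ v : (ZMod p)ˣ, ∀ β : F, walsh p f β =
      twistedWalsh p f ((v : ZMod p) ^ 2) (algebraMap (ZMod p) F (c : ZMod p) * β) := by
  obtain ⟨-, -, -, h, hpos, heven, hgcd, hhom⟩ := hf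
  exact walsh_eq_twistedWalsh_of_homogeneous p hpos heven hgcd hhom c

lemma IsWRP.walsh_smul_eq_zero_iff {n s : ℕ} {f g : F → ZMod p} {ε : ℂ}
    (hf : IsWRP p n s f ε g) (c : (ZMod p)ˣ) (β : F) :
    walsh p f (algebraMap (ZMod p) F (c : ZMod p) * β) = 0 ↔ walsh p f β = 0 := by
  obtain ⟨v, hv⟩ := hf.exists_walsh_eq_twistedWalsh c
  rw [hv β, twistedWalsh_eq_zero_iff p f (pow_ne_zero 2 v.ne_zero)]

lemma sqrtPStar_ne_zero : sqrtPStar p ≠ 0 := by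
  have : ((Real.sqrt p : ℝ) : ℂ) ≠ 0 := by
    rw [Complex.ofReal_ne_zero, Real.sqrt_ne_zero']
    exact_mod_cast (Fact.out : p.Prime).pos
  rw [sqrtPStar]
  split_ifs
  · exact this
  · exact mul_ne_zero Complex.I_ne_zero this

lemma IsWRP.exists_dual_eq_sq_mul (hp : p ≠ 2) {n s : ℕ} {f g : F → ZMod p} {ε : ℂ}
    (hf : IsWRP p n s f ε g) (c : (ZMod p)ˣ) {β : F} (hβ : walsh p f β ≠ 0) :
    ∃ v : (ZMod p)ˣ, g β = (v : ZMod p) ^ 2 * g (algebraMap (ZMod p) F (c : ZMod p) * β) := by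
  obtain ⟨v, hv⟩ := hf.exists_walsh_eq_twistedWalsh c
  refine ⟨v, ep_injective p ?_⟩
  obtain ⟨hε, hW, -⟩ := hf.1
  have hcβ := hW _ ((hf.walsh_smul_eq_zero_iff c β).not.mpr hβ)
  have h := hv β
  have hv1 : eta0 p ((v : ZMod p) ^ 2) = 1 := by
    rw [sq, eta0_mul, ← sq, eta0_sq p v.ne_zero]
  rw [twistedWalsh_eq_of_walsh_eq p hp (pow_ne_zero 2 v.ne_zero) hε hcβ, hW β hβ, hv1,
    one_mul] at h
  refine mul_left_cancel₀ (mul_ne_zero ?_ (pow_ne_zero _ (sqrtPStar_ne_zero (p := p)))) h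
  rcases hε with rfl | rfl <;> simp

end Walsh

theorem statement_7 (p n s : ℕ) [Fact p.Prime] (hp : p ≠ 2) (hn : 0 < n) (hs : s ≤ n)
    {F : Type*} [Field F] [Fintype F] [Algebra (ZMod p) F]
    (hq : Fintype.card F = p ^ n)
    (f g : F → ZMod p) (ε : ℂ)
    (hf : IsWRP p n s f ε g) :
    ∀ β : F, β ≠ 0 →
      (walsh p f β = 0 → Asum p f β = 0) ∧
      (walsh p f β ≠ 0 →
        (Even (n + s) →
          (g β = 0 →
            Asum p f β = ε * ((p : ℂ) - 1) ^ 2 * sqrtPStar p ^ (n + s)) ∧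
          (g β ≠ 0 →
            Asum p f β = -(ε * ((p : ℂ) - 1) * sqrtPStar p ^ (n + s)))) ∧
        (Odd (n + s) →
          (g β = 0 → Asum p f β = 0) ∧
          (g β ≠ 0 →
            Asum p f β
              = ε * eta0 p (g β) * ((p : ℂ) - 1) * sqrtPStar p ^ (n + s + 1)))) := by
  intro β _
  rw [Asum_eq_sum_twistedWalsh]
  obtain ⟨hε, hW, -⟩ := hf.1
  have hcard : (Fintype.card (ZMod p)ˣ : ℂ) = (p : ℂ) - 1 := by
    rw [ZMod.card_units, Nat.cast_sub (Fact.out : p.Prime).one_le, Nat.cast_one]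
  refine ⟨fun h0 => Finset.sum_eq_zero fun z _ => Finset.sum_eq_zero fun y _ => ?_, fun hβ => ?_⟩
  · rw [twistedWalsh_eq_zero_iff p f y.ne_zero, hf.walsh_smul_eq_zero_iff, h0]
  have hT : ∀ y z : (ZMod p)ˣ,
      twistedWalsh p f y (algebraMap (ZMod p) F (z : ZMod p) * β) =
        ε * (eta0 p y * sqrtPStar p) ^ (n + s) *
          ep p (y * g (algebraMap (ZMod p) F (z : ZMod p) * β)) := fun y z =>
    twistedWalsh_eq_of_walsh_eq p hp y.ne_zero hε
      (hW _ ((hf.walsh_smul_eq_zero_iff z β).not.mpr hβ))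
  simp only [hT]
  constructor
  · rintro ⟨k, hk⟩
    have hz : ∀ z : (ZMod p)ˣ,
        ∑ y : (ZMod p)ˣ, ε * (eta0 p y * sqrtPStar p) ^ (n + s) *
          ep p (y * g (algebraMap (ZMod p) F (z : ZMod p) * β)) =
        ε * sqrtPStar p ^ (n + s) * if g β = 0 then (p : ℂ) - 1 else -1 := fun z => by
      obtain ⟨v, hv⟩ := hf.exists_dual_eq_sq_mul hp z hβ
      have h0 : g β = 0 ↔ g (algebraMap (ZMod p) F (z : ZMod p) * β) = 0 := by
        rw [hv, mul_eq_zero, or_iff_right (pow_ne_zero 2 v.ne_zero)]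
      simp only [h0]
      rw [← sum_units_ep_mul, Finset.mul_sum]
      refine Finset.sum_congr rfl fun y _ => ?_
      rw [mul_pow, hk, ← two_mul, pow_mul (eta0 p y), eta0_sq p y.ne_zero, one_pow, one_mul]
    rw [Finset.sum_congr rfl fun z _ => hz z, Finset.sum_const, Finset.card_univ, nsmul_eq_mul,
      hcard]
    refine ⟨fun h => ?_, fun h => ?_⟩
    · rw [if_pos h]; ring
    · rw [if_neg h]; ring
  · rintro ⟨k, hk⟩
    have hz : ∀ z : (ZMod p)ˣ,
        ∑ y : (ZMod p)ˣ, ε * (eta0 p y * sqrtPStar p) ^ (n + s) *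
          ep p (y * g (algebraMap (ZMod p) F (z : ZMod p) * β)) =
        ε * sqrtPStar p ^ (n + s) * (eta0 p (g β) * sqrtPStar p) := fun z => by
      obtain ⟨v, hv⟩ := hf.exists_dual_eq_sq_mul hp z hβ
      have h0 : eta0 p (g β) = eta0 p (g (algebraMap (ZMod p) F (z : ZMod p) * β)) := by
        rw [hv, sq, eta0_mul, eta0_mul, ← sq, eta0_sq p v.ne_zero, one_mul]
      rw [h0, ← sum_units_eta0_mul_ep_mul p hp, Finset.mul_sum]
      refine Finset.sum_congr rfl fun y _ => ?_
      rw [mul_pow, hk, pow_succ (eta0 p y), pow_mul (eta0 p y), eta0_sq p y.ne_zero, one_pow,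
        one_mul]
      ring
    rw [Finset.sum_congr rfl fun z _ => hz z, Finset.sum_const, Finset.card_univ, nsmul_eq_mul,
      hcard]
    refine ⟨fun h => ?_, fun _ => ?_⟩
    · rw [h, eta0_zero]; ring
    · ring
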